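/- Let S be a finite set, T > 0, and Q = (q(i,j))_{i,j∈S} a generator matrix (q(i,j) ≥ 0 for i ≠ j and q(i,i) = −∑_{j≠i} q(i,j)). Let b : ℝ^d × P(ℝ^d) × S → ℝ^d and σ : ℝ^d × P(ℝ^d) × S → ℝ^{d×d} be continuous, with |b(x,μ,i)| ≤ C₀(1 + |x| + ∫|y|dμ(y)) and |σ(x,μ,i)| ≤ C₀, and set a = σσᵀ. Define L̂_i(μ)h(x) = b(x,μ,i)·∇h(x) + (1/2)trace(a(x,μ,i) Hess h(x)) for h ∈ C²_c(ℝ^d), and for g with g(·,i) ∈ C²_c(ℝ^d) define L(μ)g(x,i) = L̂_i(μ)(g(·,i))(x) + ∑_{j∈S} q(i,j)(g(x,j) − g(x,i)). Let ς : [0,T] → S be right-continuous piecewise constant with finitely many jumps and let M^ς_{ij} be the associated explicit martingale paths. Let η : [0,T] → P(ℝ^d) be such that s ↦ ∫ h dη(s) is measurable for every bounded continuous h and sup_{s∈[0,T]} ∫|x| dη(s)(x) < ∞. Assume that for every h ∈ C²_c(ℝ^d) and all 0 ≤ r ≤ t ≤ T: ∫ h dη(t) = ∫ h dη(r) + ∫_r^t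 ( ∫ L̂_{ς(s_-)}(η(s))h(x) dη(s)(x) ) ds. Then for every g with g(·,i) ∈ C²_c(ℝ^d) for each i ∈ S and every t ∈ [0,T]: ∫ g(x, ς(t)) dη(t)(x) = ∫ g(x, ς(0)) dη(0)(x) + ∫_0^t ( ∫ L(η(s))g(x, ς(s_-)) dη(s)(x) ) ds + ∑_{i≠j} ∫_0^t ( ∫ (g(x,j) − g(x,i)) dη(s)(x) ) dM^ς_{ij}(s). -/

import Mathlib

open MeasureTheory Matrix
open scoped ENNReal NNReal RealInnerProductSpace

/-- The diffusion part of the generator: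
`L̂_i(μ)h(x) = b(x,μ,i)·∇h(x) + (1/2) trace(a(x,μ,i) Hess h(x))` with `a = σσᵀ`. -/
noncomputable def Lhat {d : ℕ} {S : Type*}
    (b : EuclideanSpace ℝ (Fin d) → ProbabilityMeasure (EuclideanSpace ℝ (Fin d)) → S →
      EuclideanSpace ℝ (Fin d))
    (σm : EuclideanSpace ℝ (Fin d) → ProbabilityMeasure (EuclideanSpace ℝ (Fin d)) → S →
      Matrix (Fin d) (Fin d) ℝ)
    (i : S) (μ : ProbabilityMeasure (EuclideanSpace ℝ (Fin d)))
    (h : EuclideanSpace ℝ (Fin d) → ℝ) (x : EuclideanSpace ℝ (Fin d)) : ℝ :=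
  ⟪b x μ i, gradient h x⟫ + (1 / 2) * ∑ k, ∑ l,
    (σm x μ i * (σm x μ i)ᵀ) k l *
      fderiv ℝ (fun v => fderiv ℝ h v (EuclideanSpace.single l (1:ℝ))) x
        (EuclideanSpace.single k (1:ℝ))

/-- The integral `∫_r^τ c dM^ς_{ij}` against the explicit martingale path. -/
noncomputable def stochInt {S : Type*} [DecidableEq S] (q : S → S → ℝ) (m : ℕ)
    (t : ℕ → ℝ) (ι : ℕ → S) (ς : ℝ → S) (i j : S) (c : ℝ → ℝ) (r τ : ℝ) : ℝ :=
  (∑ k ∈ (Finset.Icc 1 m).filter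
      (fun k => r < t k ∧ t k ≤ τ ∧ ι (k - 1) = i ∧ ι k = j), c (t k)) -
    q i j * ∫ s in r..τ, Set.indicator {s' | ς s' = i} c s

section helpers
open Filter Topology

theorem aux_weak {d : ℕ} {α : Type*} {L : Filter α} [L.IsCountablyGenerated]
    (μs : α → ProbabilityMeasure (EuclideanSpace ℝ (Fin d)))
    (μ : ProbabilityMeasure (EuclideanSpace ℝ (Fin d)))
    (H : ∀ h : EuclideanSpace ℝ (Fin d) → ℝ, ContDiff ℝ 2 h → HasCompactSupport h →
      Tendsto (fun a => ∫ x, h x ∂(μs a).toMeasure) L (𝓝 (∫ x, h x ∂μ.toMeasure))) :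
    Tendsto μs L (𝓝 μ) := by
  apply tendsto_of_forall_isOpen_le_liminf'
  intro G hG
  rw [hG.measure_eq_iSup_isCompact]
  refine iSup_le fun K => iSup_le fun hKG => iSup_le fun hK => ?_
  obtain ⟨K', hK', hKK', hK'G⟩ := exists_compact_between hK hG hKG
  obtain ⟨f, hf, hfr, hfs, hf1⟩ := exists_contMDiff_support_eq_eq_one_iff (n := (2 : ℕ∞))
    (modelWithCornersSelf ℝ (EuclideanSpace ℝ (Fin d)))
    isOpen_interior hK.isClosed hKK'
  have hfc : ContDiff ℝ 2 f := hf.contDiff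
  have hsupp : HasCompactSupport f := by
    apply HasCompactSupport.of_support_subset_isCompact hK'
    rw [hfs]; exact interior_subset
  have h0 : ∀ x, 0 ≤ f x := fun x => (hfr ⟨x, rfl⟩).1
  have h1 : ∀ x, f x ≤ 1 := fun x => (hfr ⟨x, rfl⟩).2
  have hint : ∀ ν : ProbabilityMeasure (EuclideanSpace ℝ (Fin d)), Integrable f ν.toMeasure :=
    fun ν => hfc.continuous.integrable_of_hasCompactSupport hsupp
  have key := H f hfc hsupp
  have hup : ∀ ν : ProbabilityMeasure (EuclideanSpace ℝ (Fin d)),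
      ENNReal.ofReal (∫ x, f x ∂ν.toMeasure) ≤ ν.toMeasure G := by
    intro ν
    rw [ofReal_integral_eq_lintegral_ofReal (hint ν) (ae_of_all _ h0),
      ← lintegral_indicator_one hG.measurableSet]
    apply lintegral_mono
    intro x
    by_cases hx : x ∈ G
    · simp [hx, h1 x]
    · have : x ∉ Function.support f := by
        rw [hfs]; exact fun h => hx (hK'G (interior_subset h))
      simp [Function.notMem_support.1 this]
  have hlow : μ.toMeasure K ≤ ENNReal.ofReal (∫ x, f x ∂μ.toMeasure) := by
    rw [ofReal_integral_eq_lintegral_ofReal (hint μ) (ae_of_all _ h0),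
      ← lintegral_indicator_one hK.measurableSet]
    apply lintegral_mono
    intro x
    by_cases hx : x ∈ K
    · simp [hx, (hf1 x).1 hx]
    · simp [hx]
  refine hlow.trans ?_
  by_cases hL : L.NeBot
  · have := (ENNReal.continuous_ofReal.tendsto _).comp key
    rw [← this.liminf_eq]
    exact liminf_le_liminf (Eventually.of_forall fun a => hup (μs a))
  · rw [not_neBot] at hL
    subst hL
    simp

theorem aux_Phi {d : ℕ}
    (φ : EuclideanSpace ℝ (Fin d) → ProbabilityMeasure (EuclideanSpace ℝ (Fin d)) → ℝ)
    (hφ : Continuous (fun p : EuclideanSpace ℝ (Fin d) ×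
      ProbabilityMeasure (EuclideanSpace ℝ (Fin d)) => φ p.1 p.2))
    (K : Set (EuclideanSpace ℝ (Fin d))) (hK : IsCompact K) (hφK : ∀ x ∉ K, ∀ μ, φ x μ = 0) :
    Continuous (fun μ : ProbabilityMeasure (EuclideanSpace ℝ (Fin d)) =>
      ∫ x, φ x μ ∂μ.toMeasure) := by
  rw [continuous_iff_continuousAt]
  intro μ₀
  have hc : ∀ μ, Continuous (fun x => φ x μ) := fun μ =>
    hφ.comp (by fun_prop : Continuous fun x => (x, μ))
  have hs : ∀ μ, HasCompactSupport (fun x => φ x μ) := fun μ =>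
    HasCompactSupport.intro hK (fun x hx => hφK x hx μ)
  have hint : ∀ μ (ν : ProbabilityMeasure (EuclideanSpace ℝ (Fin d))),
      Integrable (fun x => φ x μ) ν.toMeasure :=
    fun μ ν => (hc μ).integrable_of_hasCompactSupport (hs μ)
  let F : C(ProbabilityMeasure (EuclideanSpace ℝ (Fin d)) × EuclideanSpace ℝ (Fin d), ℝ) :=
    ⟨fun p => φ p.2 p.1, hφ.comp continuous_swap⟩
  have hF : Tendsto F.curry (𝓝 μ₀) (𝓝 (F.curry μ₀)) := F.curry.continuous.tendsto μ₀
  rw [ContinuousMap.tendsto_iff_forall_isCompact_tendstoUniformlyOn] at hF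
  have hFK := hF K hK
  rw [Metric.tendstoUniformlyOn_iff] at hFK
  let f0 : BoundedContinuousFunction (EuclideanSpace ℝ (Fin d)) ℝ :=
    BoundedContinuousFunction.mkOfBound ⟨fun x => φ x μ₀, hc μ₀⟩
      (Classical.choose ((hs μ₀).exists_bound_of_continuous (hc μ₀)) +
        Classical.choose ((hs μ₀).exists_bound_of_continuous (hc μ₀))) (fun x y => by
        have := Classical.choose_spec ((hs μ₀).exists_bound_of_continuous (hc μ₀))
        rw [dist_eq_norm]
        exact (norm_sub_le _ _).trans (add_le_add (this x) (this y)))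
  have hw := ProbabilityMeasure.tendsto_iff_forall_integral_tendsto.1
    (tendsto_id (x := 𝓝 μ₀)) f0
  rw [Metric.tendsto_nhds] at hw
  rw [ContinuousAt, Metric.tendsto_nhds]
  intro ε hε
  filter_upwards [hw (ε / 2) (by positivity), hFK (ε / 2) (by positivity)] with μ h1 h2
  have h1' : dist (∫ x, φ x μ₀ ∂μ.toMeasure) (∫ x, φ x μ₀ ∂μ₀.toMeasure) < ε / 2 := h1
  have h3 : dist (∫ x, φ x μ ∂μ.toMeasure) (∫ x, φ x μ₀ ∂μ.toMeasure) ≤ ε / 2 := by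
    rw [dist_eq_norm, ← integral_sub (hint _ _) (hint _ _)]
    refine (norm_integral_le_of_norm_le_const (C := ε / 2) (ae_of_all _ fun x => ?_)).trans ?_
    · by_cases hx : x ∈ K
      · have := h2 x hx
        rw [dist_comm, dist_eq_norm] at this
        exact this.le
      · simp [hφK x hx]; positivity
    · simp
  linarith [dist_triangle (∫ x, φ x μ ∂μ.toMeasure) (∫ x, φ x μ₀ ∂μ.toMeasure)
    (∫ x, φ x μ₀ ∂μ₀.toMeasure)]

theorem Lhat_zero {d : ℕ} {S : Type*}
    (b : EuclideanSpace ℝ (Fin d) → ProbabilityMeasure (EuclideanSpace ℝ (Fin d)) → S →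
      EuclideanSpace ℝ (Fin d))
    (σm : EuclideanSpace ℝ (Fin d) → ProbabilityMeasure (EuclideanSpace ℝ (Fin d)) → S →
      Matrix (Fin d) (Fin d) ℝ)
    (h : EuclideanSpace ℝ (Fin d) → ℝ) (i : S) (x : EuclideanSpace ℝ (Fin d))
    (hx : x ∉ tsupport h) (μ : ProbabilityMeasure (EuclideanSpace ℝ (Fin d))) :
    Lhat b σm i μ h x = 0 := by
  have h1 : x ∉ tsupport (fderiv ℝ h) := fun hh => hx (tsupport_fderiv_subset ℝ hh)
  have h2 := notMem_tsupport_iff_eventuallyEq.1 h1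
  have h3 : fderiv ℝ h x = 0 := h2.self_of_nhds
  have h4 : ∀ l, fderiv ℝ (fun v => fderiv ℝ h v (EuclideanSpace.single l (1:ℝ))) x = 0 := by
    intro l
    have : (fun v => fderiv ℝ h v (EuclideanSpace.single l (1:ℝ))) =ᶠ[𝓝 x] fun _ => (0:ℝ) := by
      filter_upwards [h2] with v hv
      simp [hv]
    rw [this.fderiv_eq]; simp
  simp [Lhat, gradient, h3, h4]

theorem grad_cont {d : ℕ} (h : EuclideanSpace ℝ (Fin d) → ℝ) (hh : ContDiff ℝ 2 h) :
    Continuous (gradient h) := by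
  have := hh.continuous_fderiv (by norm_num)
  exact (InnerProductSpace.toDual ℝ (EuclideanSpace ℝ (Fin d))).symm.continuous.comp this

theorem hess_cont {d : ℕ} (h : EuclideanSpace ℝ (Fin d) → ℝ) (hh : ContDiff ℝ 2 h)
    (k l : Fin d) :
    Continuous (fun x => fderiv ℝ (fun v => fderiv ℝ h v (EuclideanSpace.single l (1:ℝ))) x
        (EuclideanSpace.single k (1:ℝ))) := by
  have h1 : ContDiff ℝ 1 (fderiv ℝ h) := hh.fderiv_right (by norm_num)
  have h2 : ContDiff ℝ 1 (fun v => fderiv ℝ h v (EuclideanSpace.single l (1:ℝ))) :=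
    h1.clm_apply contDiff_const
  exact (h2.continuous_fderiv (by norm_num)).clm_apply continuous_const

theorem Lhat_cont {d : ℕ} {S : Type*}
    (b : EuclideanSpace ℝ (Fin d) → ProbabilityMeasure (EuclideanSpace ℝ (Fin d)) → S →
      EuclideanSpace ℝ (Fin d))
    (σm : EuclideanSpace ℝ (Fin d) → ProbabilityMeasure (EuclideanSpace ℝ (Fin d)) → S →
      Matrix (Fin d) (Fin d) ℝ)
    (hbc : ∀ i, Continuous (fun p : EuclideanSpace ℝ (Fin d) ×
      ProbabilityMeasure (EuclideanSpace ℝ (Fin d)) => b p.1 p.2 i))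
    (hσc : ∀ i k l, Continuous (fun p : EuclideanSpace ℝ (Fin d) ×
      ProbabilityMeasure (EuclideanSpace ℝ (Fin d)) => σm p.1 p.2 i k l))
    (h : EuclideanSpace ℝ (Fin d) → ℝ) (hh : ContDiff ℝ 2 h) (i : S) :
    Continuous (fun p : EuclideanSpace ℝ (Fin d) ×
      ProbabilityMeasure (EuclideanSpace ℝ (Fin d)) => Lhat b σm i p.2 h p.1) := by
  unfold Lhat
  refine ((hbc i).inner ((grad_cont h hh).comp continuous_fst)).add (continuous_const.mul ?_)
  refine continuous_finsetSum _ fun k _ => continuous_finsetSum _ fun l _ => ?_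
  refine Continuous.mul ?_ ((hess_cont h hh k l).comp continuous_fst)
  simp only [Matrix.mul_apply, Matrix.transpose_apply]
  exact continuous_finsetSum _ fun n _ => (hσc i k n).mul (hσc i l n)

theorem cont_slice {X Y : Type*} [TopologicalSpace X] [TopologicalSpace Y]
    (φ : X → Y → ℝ) (hφ : Continuous (fun p : X × Y => φ p.1 p.2)) (y : Y) :
    Continuous (fun x => φ x y) :=
  hφ.comp (by fun_prop : Continuous fun x => (x, y))

theorem Lhat_cont_x {d : ℕ} {S : Type*}
    (b : EuclideanSpace ℝ (Fin d) → ProbabilityMeasure (EuclideanSpace ℝ (Fin d)) → S →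
      EuclideanSpace ℝ (Fin d))
    (σm : EuclideanSpace ℝ (Fin d) → ProbabilityMeasure (EuclideanSpace ℝ (Fin d)) → S →
      Matrix (Fin d) (Fin d) ℝ)
    (hbc : ∀ i, Continuous (fun p : EuclideanSpace ℝ (Fin d) ×
      ProbabilityMeasure (EuclideanSpace ℝ (Fin d)) => b p.1 p.2 i))
    (hσc : ∀ i k l, Continuous (fun p : EuclideanSpace ℝ (Fin d) ×
      ProbabilityMeasure (EuclideanSpace ℝ (Fin d)) => σm p.1 p.2 i k l))
    (h : EuclideanSpace ℝ (Fin d) → ℝ) (hh : ContDiff ℝ 2 h) (i : S)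
    (ν : ProbabilityMeasure (EuclideanSpace ℝ (Fin d))) :
    Continuous (fun x => Lhat b σm i ν h x) := by
  exact cont_slice (fun x ν => Lhat b σm i ν h x) (Lhat_cont b σm hbc hσc h hh i) ν

theorem Lhat_bound {d : ℕ} {S : Type*} (C₀ : ℝ) (hC₀ : 0 < C₀)
    (b : EuclideanSpace ℝ (Fin d) → ProbabilityMeasure (EuclideanSpace ℝ (Fin d)) → S →
      EuclideanSpace ℝ (Fin d))
    (σm : EuclideanSpace ℝ (Fin d) → ProbabilityMeasure (EuclideanSpace ℝ (Fin d)) → S →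
      Matrix (Fin d) (Fin d) ℝ)
    (hbgrowth : ∀ x μ i, Integrable (fun y => ‖y‖) μ.toMeasure →
      ‖b x μ i‖ ≤ C₀ * (1 + ‖x‖ + ∫ y, ‖y‖ ∂μ.toMeasure))
    (hσb : ∀ x μ i k l, |σm x μ i k l| ≤ C₀)
    (h : EuclideanSpace ℝ (Fin d) → ℝ) (hh : ContDiff ℝ 2 h) (hs : HasCompactSupport h)
    (B : ℝ) :
    ∃ C : ℝ, ∀ μ : ProbabilityMeasure (EuclideanSpace ℝ (Fin d)),
      (∫⁻ x, (‖x‖₊ : ℝ≥0∞) ∂μ.toMeasure) ≤ ENNReal.ofReal B →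
      ∀ i x, ‖Lhat b σm i μ h x‖ ≤ C := by
  obtain ⟨R, hR⟩ := hs.isCompact.exists_bound_of_continuousOn (f := id) continuousOn_id
  obtain ⟨C1, hC1⟩ := hs.isCompact.exists_bound_of_continuousOn (grad_cont h hh).continuousOn
  have hC2 : ∀ k l, ∃ C2, ∀ x ∈ tsupport h,
      ‖fderiv ℝ (fun v => fderiv ℝ h v (EuclideanSpace.single l (1:ℝ))) x
        (EuclideanSpace.single k (1:ℝ))‖ ≤ C2 := fun k l =>
    hs.isCompact.exists_bound_of_continuousOn (hess_cont h hh k l).continuousOn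
  choose C2 hC2 using hC2
  refine ⟨max 0 (C₀ * (1 + R + max B 0) * C1 +
    (1 / 2) * ∑ k, ∑ l, (∑ _n : Fin d, C₀ * C₀) * C2 k l), fun μ hμ i x => ?_⟩
  by_cases hx : x ∈ tsupport h
  swap
  · rw [Lhat_zero b σm h i x hx]; simp
  refine le_trans ?_ (le_max_right _ _)
  have hmi : Integrable (fun y : EuclideanSpace ℝ (Fin d) => ‖y‖) μ.toMeasure := by
    refine ⟨continuous_norm.aestronglyMeasurable, ?_⟩
    rw [hasFiniteIntegral_norm_iff]
    exact lt_of_le_of_lt hμ ENNReal.ofReal_lt_top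
  have hmB : ∫ y, ‖y‖ ∂μ.toMeasure ≤ max B 0 := by
    rw [integral_norm_eq_lintegral_enorm (f := fun y => y) continuous_id.aestronglyMeasurable]
    exact (ENNReal.toReal_mono ENNReal.ofReal_ne_top hμ).trans (by rw [ENNReal.toReal_ofReal'])
  have hb : ‖b x μ i‖ ≤ C₀ * (1 + R + max B 0) := by
    refine (hbgrowth x μ i hmi).trans ?_
    have : ‖x‖ ≤ R := hR x hx
    gcongr
  unfold Lhat
  refine (norm_add_le _ _).trans (add_le_add ?_ ?_)
  · refine (norm_inner_le_norm _ _).trans ?_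
    exact mul_le_mul hb (hC1 x hx) (norm_nonneg _) ((norm_nonneg _).trans hb)
  · rw [norm_mul]
    have : ‖(1 / 2 : ℝ)‖ = 1 / 2 := by norm_num
    rw [this]
    refine mul_le_mul_of_nonneg_left ?_ (by norm_num)
    refine (norm_sum_le _ _).trans (Finset.sum_le_sum fun k _ => ?_)
    refine (norm_sum_le _ _).trans (Finset.sum_le_sum fun l _ => ?_)
    rw [norm_mul]
    refine mul_le_mul ?_ (hC2 k l x hx) (norm_nonneg _)
      (Finset.sum_nonneg fun _ _ => by positivity)
    rw [Matrix.mul_apply]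
    refine (norm_sum_le _ _).trans (Finset.sum_le_sum fun n _ => ?_)
    rw [norm_mul, Matrix.transpose_apply]
    exact mul_le_mul (hσb _ _ _ _ _) (hσb _ _ _ _ _) (norm_nonneg _) hC₀.le

theorem Ico_congr (f g : ℝ → ℝ) (r τ : ℝ) (h : r ≤ τ) (hfg : ∀ s ∈ Set.Ico r τ, f s = g s) :
    ∫ s in r..τ, f s = ∫ s in r..τ, g s := by
  rw [intervalIntegral.integral_of_le h, intervalIntegral.integral_of_le h,
    ← integral_Ico_eq_integral_Ioc, ← integral_Ico_eq_integral_Ioc]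
  exact setIntegral_congr_fun measurableSet_Ico hfg

theorem Ico_int_congr (f g : ℝ → ℝ) (r τ : ℝ) (h : r ≤ τ) (hfg : ∀ s ∈ Set.Ico r τ, f s = g s)
    (hg : IntervalIntegrable g volume r τ) : IntervalIntegrable f volume r τ := by
  rw [intervalIntegrable_iff_integrableOn_Ico_of_le h] at hg ⊢
  exact hg.congr_fun (fun s hs => (hfg s hs).symm) measurableSet_Ico

theorem t_mono' (m : ℕ) (t : ℕ → ℝ) (htmono : ∀ k < m, t k < t (k + 1)) :
    ∀ k l, k ≤ l → l ≤ m → t k ≤ t l := by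
  intro k l hkl
  induction l, hkl using Nat.le_induction with
  | base => intro _; exact le_rfl
  | succ l hl ih => intro h; exact (ih (by omega)).trans (htmono l (by omega)).le

theorem path_integrable {S : Type*} (T : ℝ) (hT : 0 < T)
    (m : ℕ) (t : ℕ → ℝ) (ι : ℕ → S) (ς : ℝ → S)
    (ht0 : t 0 = 0) (htmono : ∀ k < m, t k < t (k + 1)) (htm : t m ≤ T)
    (hς : ∀ k < m, ∀ s, t k ≤ s → s < t (k + 1) → ς s = ι k)
    (hςlast : ∀ s, t m ≤ s → s ≤ T → ς s = ι m)
    (u : S → ℝ → ℝ) (hu : ∀ i, ContinuousOn (u i) (Set.Icc 0 T))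
    (r τ : ℝ) (h0r : 0 ≤ r) (hrτ : r ≤ τ) (hτ : τ ≤ T) :
    IntervalIntegrable (fun s => u (ς s) s) volume r τ := by
  have hmono := t_mono' m t htmono
  have hcont : ∀ i a b, 0 ≤ a → a ≤ b → b ≤ T → IntervalIntegrable (u i) volume a b := by
    intro i a b ha hab hb
    apply ContinuousOn.intervalIntegrable
    rw [Set.uIcc_of_le hab]
    exact (hu i).mono (Set.Icc_subset_Icc ha hb)
  have h1 : ∀ n ≤ m, IntervalIntegrable (fun s => u (ς s) s) volume 0 (t n) := by
    intro n
    induction n with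
    | zero => intro _; rw [ht0]
    | succ n ih =>
      intro hn
      refine (ih (by omega)).trans ?_
      refine Ico_int_congr _ (u (ι n)) _ _ (htmono n (by omega)).le ?_ ?_
      · intro s hs
        rw [hς n (by omega) s hs.1 hs.2]
      · exact hcont _ _ _ (by rw [← ht0]; exact hmono 0 n (by omega) (by omega))
          (htmono n (by omega)).le ((hmono _ m hn le_rfl).trans htm)
  have h2 : IntervalIntegrable (fun s => u (ς s) s) volume 0 T := by
    refine (h1 m le_rfl).trans (Ico_int_congr _ (u (ι m)) _ _ htm ?_ ?_)
    · intro s hs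
      rw [hςlast s hs.1 hs.2.le]
    · exact hcont _ _ _ (by rw [← ht0]; exact hmono 0 m (by omega) (by omega)) htm le_rfl
  apply h2.mono_set
  rw [Set.uIcc_of_le hrτ, Set.uIcc_of_le hT.le]
  exact Set.Icc_subset_Icc h0r hτ

theorem path_identity {S : Type*} (T : ℝ) (hT : 0 < T)
    (m : ℕ) (t : ℕ → ℝ) (ι : ℕ → S) (ς : ℝ → S)
    (ht0 : t 0 = 0) (htmono : ∀ k < m, t k < t (k + 1)) (htm : t m ≤ T)
    (hς : ∀ k < m, ∀ s, t k ≤ s → s < t (k + 1) → ς s = ι k)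
    (hςlast : ∀ s, t m ≤ s → s ≤ T → ς s = ι m)
    (F : ℝ → ℝ) (hF : ∀ r τ : ℝ, 0 ≤ r → r ≤ τ → τ ≤ T → IntervalIntegrable F volume r τ)
    (G : S → ℝ → ℝ)
    (hG : ∀ i (r τ : ℝ), 0 ≤ r → r ≤ τ → τ ≤ T → (∀ s ∈ Set.Ico r τ, ς s = i) →
      G i τ = G i r + ∫ s in r..τ, F s)
    (τ : ℝ) (hτ : τ ∈ Set.Icc (0 : ℝ) T) :
    G (ς τ) τ = G (ς 0) 0 + (∫ s in (0 : ℝ)..τ, F s) +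
      ∑ k ∈ (Finset.Icc 1 m).filter (fun k => 0 < t k ∧ t k ≤ τ),
        (G (ι k) (t k) - G (ι (k - 1)) (t k)) := by
  have hmono := t_mono' m t htmono
  have hnn : ∀ n ≤ m, 0 ≤ t n := fun n hn => by
    rw [← ht0]; exact hmono 0 n (by omega) hn
  have hle : ∀ n ≤ m, t n ≤ T := fun n hn => (hmono n m hn le_rfl).trans htm
  have hς0 : ς 0 = ι 0 := by
    rcases Nat.eq_zero_or_pos m with h | h
    · subst h; exact hςlast 0 ht0.le hT.le
    · exact hς 0 h 0 ht0.le (by rw [← ht0]; exact htmono 0 h)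
  have h1 : ∀ n ≤ m, G (ι n) (t n) = G (ι 0) 0 + (∫ s in (0 : ℝ)..(t n), F s) +
      ∑ k ∈ Finset.Icc 1 n, (G (ι k) (t k) - G (ι (k - 1)) (t k)) := by
    intro n
    induction n with
    | zero => intro _; simp [ht0]
    | succ n ih =>
      intro hn
      have e := hG (ι n) (t n) (t (n + 1)) (hnn n (by omega)) (htmono n (by omega)).le
        (hle _ hn) (fun s hs => hς n (by omega) s hs.1 hs.2)
      have e2 := intervalIntegral.integral_add_adjacent_intervals
        (hF 0 (t n) le_rfl (hnn n (by omega)) (hle n (by omega)))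
        (hF (t n) (t (n + 1)) (hnn n (by omega)) (htmono n (by omega)).le (hle _ hn))
      rw [Finset.sum_Icc_succ_top (by omega), ← e2]
      have e3 := ih (by omega)
      simp only [Nat.add_sub_cancel]
      linarith
  obtain ⟨n, hn, hnτ, hnext⟩ : ∃ n ≤ m, t n ≤ τ ∧ ∀ k ≤ m, n < k → τ < t k := by
    classical
    refine ⟨Nat.findGreatest (fun n => t n ≤ τ) m, Nat.findGreatest_le m, ?_, ?_⟩
    · exact Nat.findGreatest_spec (P := fun n => t n ≤ τ) (Nat.zero_le m)
        (by rw [ht0]; exact hτ.1)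
    · intro k hk hlt
      exact not_le.1 (Nat.findGreatest_is_greatest hlt hk)
  have hconst : ∀ s ∈ Set.Icc (t n) τ, ς s = ι n := by
    intro s hs
    rcases hn.eq_or_lt with h | h
    · subst h; exact hςlast s hs.1 (hs.2.trans hτ.2)
    · exact hς n h s hs.1 (hs.2.trans_lt (hnext (n + 1) h (by omega)))
  have hset : (Finset.Icc 1 m).filter (fun k => 0 < t k ∧ t k ≤ τ) = Finset.Icc 1 n := by
    ext k
    simp only [Finset.mem_filter, Finset.mem_Icc]
    constructor
    · rintro ⟨⟨hk1, hkm⟩, -, hk⟩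
      refine ⟨hk1, ?_⟩
      by_contra hc
      exact absurd (hnext k hkm (by omega)) (not_lt.2 hk)
    · rintro ⟨hk1, hkn⟩
      refine ⟨⟨hk1, by omega⟩, ?_, (hmono k n hkn hn).trans hnτ⟩
      have h2 := htmono 0 (by omega)
      rw [ht0] at h2
      exact h2.trans_le (hmono 1 k hk1 (by omega))
  have e := hG (ι n) (t n) τ (hnn n hn) hnτ hτ.2 (fun s hs => hconst s ⟨hs.1, hs.2.le⟩)
  have e2 := intervalIntegral.integral_add_adjacent_intervals
    (hF 0 (t n) le_rfl (hnn n hn) (hle n hn)) (hF (t n) τ (hnn n hn) hnτ hτ.2)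
  rw [hset, hconst τ ⟨hnτ, le_rfl⟩, hς0, e, h1 n hn, ← e2]
  ring

theorem jump_sum {S : Type*} [Fintype S] [DecidableEq S] (A : Finset ℕ) (P : ℕ → Prop)
    (Q : ℕ → Prop) [DecidablePred P] [DecidablePred Q]
    (t : ℕ → ℝ) (ι : ℕ → S) (G : S → ℝ → ℝ) :
    ∑ i : S, ∑ j ∈ Finset.univ.filter (fun j => j ≠ i),
      ∑ k ∈ A.filter (fun k => P k ∧ Q k ∧ ι (k - 1) = i ∧ ι k = j), (G j (t k) - G i (t k)) =
    ∑ k ∈ A.filter (fun k => P k ∧ Q k), (G (ι k) (t k) - G (ι (k - 1)) (t k)) := by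
  have e1 : ∀ i : S, ∑ j ∈ Finset.univ.filter (fun j => j ≠ i),
      ∑ k ∈ A.filter (fun k => P k ∧ Q k ∧ ι (k - 1) = i ∧ ι k = j), (G j (t k) - G i (t k)) =
      ∑ j, ∑ k ∈ A.filter (fun k => P k ∧ Q k), if ι (k - 1) = i then
        (if ι k = j then (G j (t k) - G i (t k)) else 0) else 0 := by
    intro i
    rw [Finset.sum_filter]
    refine Finset.sum_congr rfl fun j _ => ?_
    rw [Finset.sum_filter, Finset.sum_filter]
    by_cases hji : j = i
    · subst hji
      simp
    · rw [if_pos hji]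
      refine Finset.sum_congr rfl fun k _ => ?_
      by_cases h1 : P k <;> by_cases h2 : Q k <;> by_cases h3 : ι (k - 1) = i <;>
        by_cases h4 : ι k = j <;> simp [h1, h2, h3, h4]
  simp_rw [e1]
  rw [Finset.sum_congr rfl fun i _ => Finset.sum_comm, Finset.sum_comm]
  refine Finset.sum_congr rfl fun k _ => ?_
  simp

end helpers

theorem stmt14 {d : ℕ} {S : Type*} [Fintype S] [DecidableEq S] (T : ℝ) (hT : 0 < T)
    (q : S → S → ℝ) (hq1 : ∀ i j, i ≠ j → 0 ≤ q i j)
    (hq2 : ∀ i, q i i = -∑ j ∈ Finset.univ.filter (fun j => j ≠ i), q i j)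
    (C₀ : ℝ) (hC₀ : 0 < C₀)
    (b : EuclideanSpace ℝ (Fin d) → ProbabilityMeasure (EuclideanSpace ℝ (Fin d)) → S →
      EuclideanSpace ℝ (Fin d))
    (σm : EuclideanSpace ℝ (Fin d) → ProbabilityMeasure (EuclideanSpace ℝ (Fin d)) → S →
      Matrix (Fin d) (Fin d) ℝ)
    (hbc : ∀ i, Continuous (fun p : EuclideanSpace ℝ (Fin d) ×
      ProbabilityMeasure (EuclideanSpace ℝ (Fin d)) => b p.1 p.2 i))
    (hσc : ∀ i k l, Continuous (fun p : EuclideanSpace ℝ (Fin d) ×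
      ProbabilityMeasure (EuclideanSpace ℝ (Fin d)) => σm p.1 p.2 i k l))
    (hbgrowth : ∀ x μ i, Integrable (fun y => ‖y‖) μ.toMeasure →
      ‖b x μ i‖ ≤ C₀ * (1 + ‖x‖ + ∫ y, ‖y‖ ∂μ.toMeasure))
    (hσb : ∀ x μ i k l, |σm x μ i k l| ≤ C₀)
    -- the switching path
    (m : ℕ) (t : ℕ → ℝ) (ι : ℕ → S) (ς : ℝ → S)
    (ht0 : t 0 = 0) (htmono : ∀ k < m, t k < t (k + 1)) (htm : t m ≤ T)
    (hς : ∀ k < m, ∀ s, t k ≤ s → s < t (k + 1) → ς s = ι k)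
    (hςlast : ∀ s, t m ≤ s → s ≤ T → ς s = ι m)
    -- the measure-valued path
    (η : ℝ → ProbabilityMeasure (EuclideanSpace ℝ (Fin d)))
    (hηm : ∀ h : BoundedContinuousFunction (EuclideanSpace ℝ (Fin d)) ℝ,
      Measurable (fun s => ∫ x, h x ∂(η s).toMeasure))
    (B : ℝ) (hηmom : ∀ s ∈ Set.Icc (0:ℝ) T,
      (∫⁻ x, (‖x‖₊ : ℝ≥0∞) ∂(η s).toMeasure) ≤ ENNReal.ofReal B)
    -- the path solves the equation driven by the frozen diffusion operators
    (heq : ∀ h : EuclideanSpace ℝ (Fin d) → ℝ, ContDiff ℝ 2 h → HasCompactSupport h →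
      ∀ r τ : ℝ, 0 ≤ r → r ≤ τ → τ ≤ T →
        (∫ x, h x ∂(η τ).toMeasure) = (∫ x, h x ∂(η r).toMeasure) +
          ∫ s in r..τ, ∫ x, Lhat b σm (ς s) (η s) h x ∂(η s).toMeasure) :
    -- then the full McKean–Vlasov identity with switching holds
    ∀ g : EuclideanSpace ℝ (Fin d) → S → ℝ,
      (∀ i, ContDiff ℝ 2 (fun x => g x i)) → (∀ i, HasCompactSupport (fun x => g x i)) →
      ∀ τ ∈ Set.Icc (0:ℝ) T,
        (∫ x, g x (ς τ) ∂(η τ).toMeasure) = (∫ x, g x (ς 0) ∂(η 0).toMeasure) +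
          (∫ s in (0:ℝ)..τ, ∫ x,
            (Lhat b σm (ς s) (η s) (fun y => g y (ς s)) x +
              ∑ j, q (ς s) j * (g x j - g x (ς s))) ∂(η s).toMeasure) +
          (∑ i : S, ∑ j ∈ Finset.univ.filter (fun j => j ≠ i),
            stochInt q m t ι ς i j
              (fun s => ∫ x, (g x j - g x i) ∂(η s).toMeasure) 0 τ) := by

  intro g hg hgs τ hτ
  have hgi : ∀ i (ν : ProbabilityMeasure (EuclideanSpace ℝ (Fin d))),
      Integrable (fun x => g x i) ν.toMeasure := fun i ν =>
    (hg i).continuous.integrable_of_hasCompactSupport (hgs i)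
  -- weak continuity of the path
  have hηc : ContinuousOn η (Set.Icc 0 T) := by
    intro s₀ hs₀
    apply aux_weak
    intro h hh hs
    obtain ⟨C, hC⟩ := Lhat_bound C₀ hC₀ b σm hbgrowth hσb h hh hs B
    have hlip : ∀ r τ : ℝ, 0 ≤ r → r ≤ τ → τ ≤ T →
        |(∫ x, h x ∂(η τ).toMeasure) - ∫ x, h x ∂(η r).toMeasure| ≤ C * |τ - r| := by
      intro r τ hr hrτ hτ
      rw [heq h hh hs r τ hr hrτ hτ, add_sub_cancel_left, ← Real.norm_eq_abs]
      apply intervalIntegral.norm_integral_le_of_norm_le_const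
      intro s hsm
      rw [Set.uIoc_of_le hrτ] at hsm
      refine (norm_integral_le_of_norm_le_const (C := C) (ae_of_all _ fun x =>
        hC (η s) (hηmom s ⟨hr.trans hsm.1.le, hsm.2.trans hτ⟩) _ x)).trans ?_
      simp
    have hlip' : ∀ s ∈ Set.Icc (0:ℝ) T,
        |(∫ x, h x ∂(η s).toMeasure) - ∫ x, h x ∂(η s₀).toMeasure| ≤ C * |s - s₀| := by
      intro s hsm
      rcases le_total s s₀ with hl | hl
      · rw [abs_sub_comm, abs_sub_comm s]
        exact hlip s s₀ hsm.1 hl hs₀.2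
      · exact hlip s₀ s hs₀.1 hl hsm.2
    rw [tendsto_iff_norm_sub_tendsto_zero]
    have hlim : Filter.Tendsto (fun s => C * |s - s₀|) (nhdsWithin s₀ (Set.Icc 0 T)) (nhds 0) := by
      have : Continuous (fun s => C * |s - s₀|) := by fun_prop
      have h2 := (this.tendsto s₀).mono_left (nhdsWithin_le_nhds (s := Set.Icc 0 T))
      simpa using h2
    refine squeeze_zero' (Filter.Eventually.of_forall fun s => norm_nonneg _) ?_ hlim
    filter_upwards [self_mem_nhdsWithin] with s hsm
    exact hlip' s hsm
  have hLi : ∀ i (ν : ProbabilityMeasure (EuclideanSpace ℝ (Fin d))),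
      Integrable (fun x => Lhat b σm i ν (fun y => g y i) x) ν.toMeasure := by
    intro i ν
    have hc : Continuous (fun x => Lhat b σm i ν (fun y => g y i) x) :=
      Lhat_cont_x b σm hbc hσc _ (hg i) i ν
    exact hc.integrable_of_hasCompactSupport
      (HasCompactSupport.intro (hgs i) (fun x hx => Lhat_zero b σm _ i x hx ν))
  let G : S → ℝ → ℝ := fun i s => ∫ x, g x i ∂(η s).toMeasure
  let D : S → ℝ → ℝ := fun i s => ∫ x, Lhat b σm i (η s) (fun y => g y i) x ∂(η s).toMeasure
  have hGc : ∀ i, ContinuousOn (G i) (Set.Icc 0 T) := by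
    intro i
    have := aux_Phi (fun x _ => g x i) ((hg i).continuous.comp continuous_fst) _ (hgs i)
      (fun x hx _ => image_eq_zero_of_notMem_tsupport (f := fun x => g x i) hx)
    exact this.comp_continuousOn hηc
  have hDc : ∀ i, ContinuousOn (D i) (Set.Icc 0 T) := by
    intro i
    have := aux_Phi (fun x ν => Lhat b σm i ν (fun y => g y i) x)
      (Lhat_cont b σm hbc hσc _ (hg i) i) _ (hgs i)
      (fun x hx ν => Lhat_zero b σm _ i x hx ν)
    exact this.comp_continuousOn hηc
  have hPI := path_integrable T hT m t ι ς ht0 htmono htm hς hςlast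
  have hmain := path_identity T hT m t ι ς ht0 htmono htm hς hςlast
    (fun s => D (ς s) s) (hPI D hDc) G (by
      intro i r τ hr hrτ hτ hconst
      have e := heq (fun x => g x i) (hg i) (hgs i) r τ hr hrτ hτ
      refine e.trans ?_
      congr 1
      refine Ico_congr _ _ _ _ hrτ fun s hs => ?_
      simp only [D, hconst s hs]) τ hτ
  -- rewrite the drift term
  have hsub : ∀ i j s, ∫ x, (g x j - g x i) ∂(η s).toMeasure = G j s - G i s := fun i j s =>
    integral_sub (hgi j _) (hgi i _)
  let R : S → ℝ → ℝ := fun i s => ∑ j, q i j * (G j s - G i s)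
  have hRc : ∀ i, ContinuousOn (R i) (Set.Icc 0 T) := fun i =>
    continuousOn_finsetSum _ fun j _ => continuousOn_const.mul ((hGc j).sub (hGc i))
  have hdrift : (∫ s in (0:ℝ)..τ, ∫ x,
            (Lhat b σm (ς s) (η s) (fun y => g y (ς s)) x +
              ∑ j, q (ς s) j * (g x j - g x (ς s))) ∂(η s).toMeasure) =
      (∫ s in (0:ℝ)..τ, D (ς s) s) + ∫ s in (0:ℝ)..τ, R (ς s) s := by
    rw [← intervalIntegral.integral_add (hPI D hDc 0 τ le_rfl hτ.1 hτ.2)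
      (hPI R hRc 0 τ le_rfl hτ.1 hτ.2)]
    congr 1
    funext s
    have hi : ∀ j ∈ Finset.univ, Integrable (fun x => q (ς s) j * (g x j - g x (ς s)))
        (η s).toMeasure := fun j _ => ((hgi j _).sub (hgi _ _)).const_mul _
    rw [integral_add (hLi _ _) (integrable_finsetSum _ hi), integral_finsetSum _ hi]
    simp only [integral_const_mul, hsub, D, R]
  have hind : ∀ i j, IntervalIntegrable
      (Set.indicator {s' | ς s' = i} (fun s => G j s - G i s)) volume 0 τ := by
    intro i j
    have := hPI (fun k s => if k = i then G j s - G i s else 0) (by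
      intro k
      by_cases hk : k = i
      · simp only [hk, if_true]; exact (hGc j).sub (hGc i)
      · simp only [hk, if_false]; exact continuousOn_const) 0 τ le_rfl hτ.1 hτ.2
    refine this.congr (fun s _ => ?_)
    simp [Set.indicator_apply]
  have hcomp : ∑ i : S, ∑ j ∈ Finset.univ.filter (fun j => j ≠ i),
      q i j * ∫ s in (0:ℝ)..τ, Set.indicator {s' | ς s' = i} (fun s => G j s - G i s) s =
      ∫ s in (0:ℝ)..τ, R (ς s) s := by
    simp_rw [← intervalIntegral.integral_const_mul]
    rw [Finset.sum_congr rfl fun i _ => (intervalIntegral.integral_finsetSum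
      fun j _ => (hind i j).const_mul (q i j)).symm]
    have hs2 : ∀ i ∈ (Finset.univ : Finset S), IntervalIntegrable (fun x =>
        ∑ j ∈ Finset.univ.filter (fun j => j ≠ i),
          q i j * Set.indicator {s' | ς s' = i} (fun s => G j s - G i s) x) volume 0 τ := by
      intro i _
      have := IntervalIntegrable.sum (Finset.univ.filter (fun j => j ≠ i))
        fun j _ => (hind i j).const_mul (q i j)
      refine this.congr (fun x _ => ?_)
      simp only [Finset.sum_apply]
    rw [← intervalIntegral.integral_finsetSum hs2]
    congr 1
    funext s
    rw [Finset.sum_eq_single (ς s)]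
    · simp only [R]
      rw [Finset.sum_filter]
      refine Finset.sum_congr rfl fun j _ => ?_
      by_cases hj : j = ς s
      · simp [hj]
      · simp [hj, Set.indicator_apply]
    · intro i _ hi
      refine Finset.sum_eq_zero fun j _ => ?_
      simp [Set.indicator_apply, Ne.symm hi]
    · simp
  have hstoch : (∑ i : S, ∑ j ∈ Finset.univ.filter (fun j => j ≠ i),
            stochInt q m t ι ς i j
              (fun s => ∫ x, (g x j - g x i) ∂(η s).toMeasure) 0 τ) =
      (∑ k ∈ (Finset.Icc 1 m).filter (fun k => 0 < t k ∧ t k ≤ τ),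
        (G (ι k) (t k) - G (ι (k - 1)) (t k))) - ∫ s in (0:ℝ)..τ, R (ς s) s := by
    rw [← hcomp, ← jump_sum, ← Finset.sum_sub_distrib]
    refine Finset.sum_congr rfl fun i _ => ?_
    rw [← Finset.sum_sub_distrib]
    refine Finset.sum_congr rfl fun j _ => ?_
    simp only [stochInt, hsub]
  rw [hdrift, hstoch]
  have hmain' : (∫ x, g x (ς τ) ∂(η τ).toMeasure) = (∫ x, g x (ς 0) ∂(η 0).toMeasure) +
    (∫ s in (0 : ℝ)..τ, D (ς s) s) +
      ∑ k ∈ (Finset.Icc 1 m).filter (fun k => 0 < t k ∧ t k ≤ τ),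
        (G (ι k) (t k) - G (ι (k - 1)) (t k)) := hmain
  rw [hmain']
  ring
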